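/- For each n ∈ ℕ let (Y₀⁽ⁿ⁾, Y₁⁽ⁿ⁾, …, Y_d⁽ⁿ⁾) be a random vector such that each component Y_i⁽ⁿ⁾ (0 ≤ i ≤ d) has distribution function F_n(x) = (1 + x/n)ⁿ for x ∈ [−n, 0] (F_n(x) = 0 for x < −n, F_n(x) = 1 for x > 0). Let g₁, …, g_d > 0 and set Ŷ⁽ⁿ⁾ := max_{1≤i≤d} Y_i⁽ⁿ⁾/g_i. Suppose the pair (Y₀⁽ⁿ⁾, Ŷ⁽ⁿ⁾) converges in distribution, as n → ∞, to a random vector (η, η̂) that is standard max-stable with some generator (Z₁, Z₂). Then E[(Y₀⁽ⁿ⁾ − Ŷ⁽ⁿ⁾)²] → E[(η − η̂)²] as n → ∞. -/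

import Mathlib

open MeasureTheory ProbabilityTheory Filter Topology BoundedContinuousFunction

/-- A uniform bound on fourth moments, expressed through the tail `t ↦ exp (-t)`. -/
theorem exists_fourth_moment_bound_of_exponential_tail :
    ∃ C : ℝ, 0 ≤ C ∧ ∀ {Ω : Type*} [MeasurableSpace Ω] (μ : Measure Ω) [IsProbabilityMeasure μ]
      (X : Ω → ℝ), Measurable X → (∀ᵐ ω ∂μ, X ω ≤ 0) →
      (∀ t : ℝ, 0 < t → (μ {ω | X ω ≤ -t}).toReal ≤ Real.exp (-t)) →
      Integrable (fun ω => X ω ^ 4) μ ∧ ∫ ω, X ω ^ 4 ∂μ ≤ C := by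
  set K : ENNReal := ENNReal.ofReal 4 *
    ∫⁻ t in Set.Ioi (0 : ℝ), ENNReal.ofReal (Real.exp (-t) * t ^ ((4 : ℝ) - 1)) with hK
  have hKtop : K ≠ ⊤ :=
    ENNReal.mul_ne_top ENNReal.ofReal_ne_top
      (Real.GammaIntegral_convergent (by norm_num : (0 : ℝ) < 4)).lintegral_lt_top.ne
  refine ⟨K.toReal, ENNReal.toReal_nonneg, fun {Ω} _ μ _ X hX hneg htail => ?_⟩
  have hle : ∫⁻ ω, ENNReal.ofReal (X ω ^ 4) ∂μ ≤ K := by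
    have hcake := lintegral_rpow_eq_lintegral_meas_le_mul μ (f := fun ω => -X ω)
      (by filter_upwards [hneg] with ω h using by simpa using h) hX.neg.aemeasurable
      (by norm_num : (0 : ℝ) < 4)
    have hpow : ∀ ω, ENNReal.ofReal (X ω ^ 4) = ENNReal.ofReal ((-X ω) ^ (4 : ℝ)) := by
      intro ω
      congr 1
      rw [show (4 : ℝ) = ((4 : ℕ) : ℝ) by norm_num, Real.rpow_natCast]
      ring
    simp_rw [hpow]
    rw [hcake, hK]
    refine mul_le_mul' le_rfl (setLIntegral_mono' measurableSet_Ioi fun t ht => ?_)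
    rw [ENNReal.ofReal_mul (Real.exp_nonneg _)]
    gcongr
    refine (ENNReal.le_ofReal_iff_toReal_le (measure_ne_top _ _) (Real.exp_nonneg _)).2 ?_
    simpa only [le_neg] using htail t ht
  have hnn : 0 ≤ᵐ[μ] fun ω => X ω ^ 4 := ae_of_all _ fun ω => by positivity
  have hm : AEStronglyMeasurable (fun ω => X ω ^ 4) μ := (hX.pow_const 4).aestronglyMeasurable
  refine ⟨(lintegral_ofReal_ne_top_iff_integrable hm hnn).1 (hle.trans_lt hKtop.lt_top).ne, ?_⟩
  rw [integral_eq_lintegral_of_nonneg_ae hnn hm]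
  exact ENNReal.toReal_mono hKtop hle

theorem sub_pow_four_le_of_nonpos {a b : ℝ} (ha : a ≤ 0) (hb : b ≤ 0) :
    (a - b) ^ 4 ≤ a ^ 4 + b ^ 4 := by
  have h1 : (a - b) ^ 2 ≤ a ^ 2 + b ^ 2 := by nlinarith [mul_nonneg_of_nonpos_of_nonpos ha hb]
  rcases le_total a b with h | h
  · have : (b - a) ^ 4 ≤ (-a) ^ 4 := by
      gcongr
      linarith
    nlinarith [sq_nonneg (b ^ 2)]
  · have : (a - b) ^ 4 ≤ (-b) ^ 4 := by
      gcongr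
      linarith
    nlinarith [sq_nonneg (a ^ 2)]

/-- The fourth moment of a difference of nonpositive variables is controlled by those of
lower bounds. -/
theorem integral_sub_pow_four_le {Ω : Type*} [MeasurableSpace Ω] {μ : Measure Ω}
    {A B V : Ω → ℝ} {c C : ℝ} (hA : Measurable A) (hB : Measurable B)
    (hA0 : ∀ᵐ ω ∂μ, A ω ≤ 0) (hB0 : ∀ᵐ ω ∂μ, B ω ≤ 0) (hVB : ∀ ω, V ω / c ≤ B ω)
    (hAi : Integrable (fun ω => A ω ^ 4) μ) (hAC : ∫ ω, A ω ^ 4 ∂μ ≤ C)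
    (hVi : Integrable (fun ω => V ω ^ 4) μ) (hVC : ∫ ω, V ω ^ 4 ∂μ ≤ C) :
    Integrable (fun ω => (A ω - B ω) ^ 4) μ ∧ ∫ ω, (A ω - B ω) ^ 4 ∂μ ≤ C + C / c ^ 4 := by
  have hbound : ∀ᵐ ω ∂μ, (A ω - B ω) ^ 4 ≤ A ω ^ 4 + V ω ^ 4 / c ^ 4 := by
    filter_upwards [hA0, hB0] with ω ha hb
    have h : (-B ω) ^ 4 ≤ (-(V ω / c)) ^ 4 := by
      gcongr
      · linarith
      · exact hVB ω
    rw [Even.neg_pow (by decide), Even.neg_pow (by decide), div_pow] at h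
    linarith [sub_pow_four_le_of_nonpos ha hb]
  have hi : Integrable (fun ω => A ω ^ 4 + V ω ^ 4 / c ^ 4) μ := hAi.add (hVi.div_const _)
  have hint : Integrable (fun ω => (A ω - B ω) ^ 4) μ := by
    refine hi.mono' ((hA.sub hB).pow_const 4).aestronglyMeasurable ?_
    filter_upwards [hbound] with ω h
    rwa [Real.norm_of_nonneg (by positivity)]
  refine ⟨hint, (integral_mono_ae hint hi hbound).trans ?_⟩
  rw [integral_add hAi (hVi.div_const _), integral_div]
  gcongr

theorem abs_integral_sq_sub_integral_min_le {Ω : Type*} [MeasurableSpace Ω] {μ : Measure Ω}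
    [IsProbabilityMeasure μ] {W : Ω → ℝ} {C M : ℝ} (hM : 0 < M) (hW : Measurable W)
    (hi : Integrable (fun ω => W ω ^ 4) μ) (hC : ∫ ω, W ω ^ 4 ∂μ ≤ C) :
    |∫ ω, W ω ^ 2 ∂μ - ∫ ω, min (W ω ^ 2) M ∂μ| ≤ C / M := by
  have h2 : Integrable (fun ω => W ω ^ 2) μ := by
    refine (hi.add (integrable_const (1 : ℝ))).mono' (hW.pow_const 2).aestronglyMeasurable
      (ae_of_all _ fun ω => ?_)
    rw [Real.norm_of_nonneg (by positivity)]
    simp only [Pi.add_apply]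
    nlinarith [sq_nonneg (W ω ^ 2 - 1)]
  have hmin : Integrable (fun ω => min (W ω ^ 2) M) μ := h2.inf (integrable_const M)
  rw [← integral_sub h2 hmin, abs_of_nonneg
    (integral_nonneg fun ω => sub_nonneg.2 (min_le_left _ _))]
  calc ∫ ω, (W ω ^ 2 - min (W ω ^ 2) M) ∂μ ≤ ∫ ω, W ω ^ 4 / M ∂μ := by
        refine integral_mono (h2.sub hmin) (hi.div_const M) fun ω => ?_
        simp only
        rw [le_div_iff₀ hM]
        rcases le_total (W ω ^ 2) M with h | h
        · rw [min_eq_left h]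
          nlinarith [sq_nonneg (W ω ^ 2)]
        · rw [min_eq_right h]
          nlinarith [sq_nonneg (W ω ^ 2 - M)]
    _ ≤ C / M := by
        rw [integral_div]
        gcongr

theorem toReal_tail_le_exp_neg {n : ℕ} (hn : 1 ≤ n) {t : ℝ} (ht : 0 < t) :
    (if -t < -(n : ℝ) then 0 else if -t ≤ 0 then (1 + -t / n) ^ n else 1)
      ≤ Real.exp (-t) := by
  have hn0 : (0 : ℝ) < n := by exact_mod_cast hn
  split_ifs with h1 h2
  · positivity
  · have h0 : 0 ≤ 1 + -t / n := by
      rw [neg_div, ← sub_eq_add_neg, sub_nonneg, div_le_one hn0]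
      linarith
    calc (1 + -t / n) ^ n ≤ Real.exp (-t / n) ^ n := by
          gcongr
          linarith [Real.add_one_le_exp (-t / n)]
      _ = Real.exp (-t) := by
          rw [← Real.exp_nat_mul]
          congr 1
          field_simp
  · linarith

theorem ae_nonpos_of_toReal_eq_one {Ω : Type*} [MeasurableSpace Ω] {μ : Measure Ω}
    [IsProbabilityMeasure μ] {X : Ω → ℝ} (hX : Measurable X)
    (h : (μ {ω | X ω ≤ 0}).toReal = 1) : ∀ᵐ ω ∂μ, X ω ≤ 0 :=
  (mem_ae_iff_prob_eq_one (measurableSet_le hX measurable_const)).2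
    ((ENNReal.toReal_eq_one_iff _).1 h)

/-- For each `n` let `(Y₀⁽ⁿ⁾, Y₁⁽ⁿ⁾, …, Y_d⁽ⁿ⁾)` be a random vector whose
components have distribution function `F_n(x) = (1 + x/n)ⁿ` on `[-n, 0]` (`0` below, `1`
above), let `g₁, …, g_d > 0` and `Ŷ⁽ⁿ⁾ = max_i Y_i⁽ⁿ⁾ / g_i`.  If `(Y₀⁽ⁿ⁾, Ŷ⁽ⁿ⁾)`
converges in distribution to a standard max-stable random vector `(η, η̂)` with generator
`(Z₁, Z₂)`, then `E ((Y₀⁽ⁿ⁾ - Ŷ⁽ⁿ⁾)²) → E ((η - η̂)²)` as `n → ∞`. -/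
theorem mse_convergence_for_domain_of_attraction
    {d : ℕ} (hd : 0 < d) (g : Fin d → ℝ) (hg : ∀ i, 0 < g i)
    (Ωn : ℕ → Type*) [∀ n, MeasureSpace (Ωn n)]
    [∀ n, IsProbabilityMeasure (ℙ : Measure (Ωn n))]
    (Y₀ : (n : ℕ) → Ωn n → ℝ) (Y : (n : ℕ) → Fin d → Ωn n → ℝ)
    (hY₀meas : ∀ n, Measurable (Y₀ n)) (hYmeas : ∀ n i, Measurable (Y n i))
    (hY₀df : ∀ n, 1 ≤ n → ∀ x : ℝ,
      (ℙ {ω | Y₀ n ω ≤ x}).toReal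
        = if x < -(n : ℝ) then 0 else if x ≤ 0 then (1 + x / n) ^ n else 1)
    (hYdf : ∀ n, 1 ≤ n → ∀ i, ∀ x : ℝ,
      (ℙ {ω | Y n i ω ≤ x}).toReal
        = if x < -(n : ℝ) then 0 else if x ≤ 0 then (1 + x / n) ^ n else 1)
    {Ω' : Type*} [MeasureSpace Ω'] [IsProbabilityMeasure (ℙ : Measure Ω')]
    (Z₁ Z₂ η ηhat : Ω' → ℝ)
    (hZ₁int : Integrable Z₁) (hZ₂int : Integrable Z₂)
    (hZ₁pos : ∀ᵐ ω ∂ℙ, 0 ≤ Z₁ ω) (hZ₂pos : ∀ᵐ ω ∂ℙ, 0 ≤ Z₂ ω)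
    (hZ₁one : ∫ ω, Z₁ ω = 1) (hZ₂one : ∫ ω, Z₂ ω = 1)
    (hηmeas : Measurable η) (hηhatmeas : Measurable ηhat)
    (hηneg : ∀ᵐ ω ∂ℙ, η ω ≤ 0) (hηhatneg : ∀ᵐ ω ∂ℙ, ηhat ω ≤ 0)
    (hmaxstable : ∀ x y : ℝ, x ≤ 0 → y ≤ 0 →
      (ℙ {ω | η ω ≤ x ∧ ηhat ω ≤ y}).toReal
        = Real.exp (-(∫ ω, max (|x| * Z₁ ω) (|y| * Z₂ ω))))
    (hweak : ∀ f : (ℝ × ℝ) →ᵇ ℝ,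
      Tendsto (fun n => ∫ ω, f (Y₀ n ω, ⨆ i, Y n i ω / g i)) atTop
        (𝓝 (∫ ω, f (η ω, ηhat ω)))) :
    Tendsto (fun n => ∫ ω, (Y₀ n ω - ⨆ i, Y n i ω / g i) ^ 2) atTop
      (𝓝 (∫ ω, (η ω - ηhat ω) ^ 2)) := by
  have hd' : Nonempty (Fin d) := ⟨⟨0, hd⟩⟩
  let i₀ : Fin d := ⟨0, hd⟩
  obtain ⟨C, hC0, hC⟩ := exists_fourth_moment_bound_of_exponential_tail.{u_1}
  obtain ⟨C', hC0', hC'⟩ := exists_fourth_moment_bound_of_exponential_tail.{u_2}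
  have hsup : ∀ n, Measurable fun ω => ⨆ i, Y n i ω / g i := fun n =>
    Measurable.iSup fun i => (hYmeas n i).div_const _
  have hYneg : ∀ n, 1 ≤ n → ∀ i, ∀ᵐ ω, Y n i ω ≤ 0 := fun n hn i =>
    ae_nonpos_of_toReal_eq_one (hYmeas n i) (by rw [hYdf n hn i]; simp)
  have hY₀neg : ∀ n, 1 ≤ n → ∀ᵐ ω, Y₀ n ω ≤ 0 := fun n hn =>
    ae_nonpos_of_toReal_eq_one (hY₀meas n) (by rw [hY₀df n hn]; simp)
  have hpre : ∀ n, 1 ≤ n →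
      Integrable (fun ω => (Y₀ n ω - ⨆ i, Y n i ω / g i) ^ 4) ∧
      ∫ ω, (Y₀ n ω - ⨆ i, Y n i ω / g i) ^ 4 ≤ C + C / g i₀ ^ 4 := by
    intro n hn
    obtain ⟨h1, h2⟩ := hC ℙ (Y₀ n) (hY₀meas n) (hY₀neg n hn) fun t ht => by
      rw [hY₀df n hn]
      exact toReal_tail_le_exp_neg hn ht
    obtain ⟨h3, h4⟩ := hC ℙ (Y n i₀) (hYmeas n i₀) (hYneg n hn i₀) fun t ht => by
      rw [hYdf n hn]
      exact toReal_tail_le_exp_neg hn ht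
    refine integral_sub_pow_four_le (hY₀meas n) (hsup n) (hY₀neg n hn) ?_ ?_ h1 h2 h3 h4
    · filter_upwards [ae_all_iff.2 (hYneg n hn)] with ω h
      exact ciSup_le fun i => div_nonpos_of_nonpos_of_nonneg (h i) (hg i).le
    · exact fun ω => le_ciSup (f := fun i => Y n i ω / g i) (Set.finite_range _).bddAbove i₀
  have hlim : Integrable (fun ω => (η ω - ηhat ω) ^ 4) ∧
      ∫ ω, (η ω - ηhat ω) ^ 4 ≤ C' + C' / 1 ^ 4 := by
    obtain ⟨h1, h2⟩ := hC' ℙ η hηmeas hηneg fun t ht => by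
      have hmarg := hmaxstable (-t) 0 (by linarith) le_rfl
      have hset : (ℙ {ω | η ω ≤ -t ∧ ηhat ω ≤ 0} : ENNReal) = ℙ {ω | η ω ≤ -t} := by
        refine measure_congr ?_
        filter_upwards [hηhatneg] with ω h
        exact propext (and_iff_left h)
      have hint : ∫ ω, max (|-t| * Z₁ ω) (|(0 : ℝ)| * Z₂ ω) = t := by
        rw [integral_congr_ae (g := fun ω => t * Z₁ ω), integral_const_mul, hZ₁one, mul_one]
        filter_upwards [hZ₁pos] with ω h
        rw [abs_neg, abs_of_pos ht, abs_zero, zero_mul, max_eq_left (by positivity)]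
      rw [hset, hint] at hmarg
      exact hmarg.le
    obtain ⟨h3, h4⟩ := hC' ℙ ηhat hηhatmeas hηhatneg fun t ht => by
      have hmarg := hmaxstable 0 (-t) le_rfl (by linarith)
      have hset : (ℙ {ω | η ω ≤ 0 ∧ ηhat ω ≤ -t} : ENNReal) = ℙ {ω | ηhat ω ≤ -t} := by
        refine measure_congr ?_
        filter_upwards [hηneg] with ω h
        exact propext (and_iff_right h)
      have hint : ∫ ω, max (|(0 : ℝ)| * Z₁ ω) (|-t| * Z₂ ω) = t := by
        rw [integral_congr_ae (g := fun ω => t * Z₂ ω), integral_const_mul, hZ₂one, mul_one]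
        filter_upwards [hZ₂pos] with ω h
        rw [abs_neg, abs_of_pos ht, abs_zero, zero_mul, max_eq_right (by positivity)]
      rw [hset, hint] at hmarg
      exact hmarg.le
    exact integral_sub_pow_four_le hηmeas hηhatmeas hηneg hηhatneg
      (fun ω => (div_one _).le) h1 h2 h3 h4
  have htrunc : ∀ M : ℝ, 0 < M →
      Tendsto (fun n => ∫ ω, min ((Y₀ n ω - ⨆ i, Y n i ω / g i) ^ 2) M) atTop
        (𝓝 (∫ ω, min ((η ω - ηhat ω) ^ 2) M)) := fun M hM =>
    hweak (BoundedContinuousFunction.ofNormedAddCommGroup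
      (fun p : ℝ × ℝ => min ((p.1 - p.2) ^ 2) M) (by fun_prop) M fun p => by
        rw [Real.norm_of_nonneg (le_min (sq_nonneg _) hM.le)]
        exact min_le_right _ _)
  rw [Metric.tendsto_atTop]
  intro ε hε
  set K : ℝ := (C + C / g i₀ ^ 4) + (C' + C' / 1 ^ 4) + 1 with hK
  have hgi := hg i₀
  have hCg : 0 ≤ C + C / g i₀ ^ 4 := by positivity
  have hCg' : 0 ≤ C' + C' / 1 ^ 4 := by positivity
  have hKpos : 0 < K := by linarith
  have hMpos : 0 < 3 * K / ε := by positivity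
  have hKM : K / (3 * K / ε) = ε / 3 := by field_simp
  obtain ⟨N, hN⟩ := Metric.tendsto_atTop.1 (htrunc _ hMpos) (ε / 3) (by positivity)
  refine ⟨max N 1, fun n hn => ?_⟩
  have e1 := hN n (le_of_max_le_left hn)
  obtain ⟨hi, hb⟩ := hpre n (le_of_max_le_right hn)
  have e2 := abs_integral_sq_sub_integral_min_le hMpos ((hY₀meas n).sub (hsup n)) hi
    (hb.trans (by linarith : _ ≤ K))
  have e3 := abs_integral_sq_sub_integral_min_le hMpos (hηmeas.sub hηhatmeas) hlim.1
    (hlim.2.trans (by linarith : _ ≤ K))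
  rw [hKM] at e2 e3
  rw [Real.dist_eq] at e1 ⊢
  simp only [Pi.sub_apply] at e2 e3
  rw [abs_lt] at e1 ⊢
  rw [abs_le] at e2 e3
  constructor <;> linarith [e1.1, e1.2, e2.1, e2.2, e3.1, e3.2]
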